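/- arXiv:2209.09847 — 2 statements merged into one kernel-verified Lean document; each statement's English description precedes it below -/
import Mathlib

section
/- (Theorem 1: MARC holds in zero-sum games.) Let G be any finite two-player zero-sum game (u_2 = −u_1). Then there exist mixed strategies s_1 of player 1 and s_2 of player 2 such that: (i) s_1 is a best response to s_2 and s_2 is a best response to s_1 (so, taking each player's conjecture equal to the opponent's actual strategy, each player is both rational and correct), and (ii) s_1 solves player 1's Definition-4 problem and s_2 solves player 2's Definition-4 problem. -/
/-- A mixed strategy: nonnegative weights summing to one. -/
def IsMixed {α : Type*} [Fintype α] (s : α → ℝ) : Prop :=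
  (∀ a, 0 ≤ s a) ∧ ∑ a, s a = 1

/-- Expected payoff in a two-player game with payoff function `u`. -/
noncomputable def U {α β : Type*} [Fintype α] [Fintype β]
    (u : α → β → ℝ) (t₁ : α → ℝ) (t₂ : β → ℝ) : ℝ :=
  ∑ a, ∑ b, t₁ a * t₂ b * u a b

/-- `s₁` is a (mixed) best response of player 1 to `t₂`. -/
def IsBR1 {α β : Type*} [Fintype α] [Fintype β]
    (u₁ : α → β → ℝ) (s₁ : α → ℝ) (t₂ : β → ℝ) : Prop :=
  IsMixed s₁ ∧ ∀ t₁, IsMixed t₁ → U u₁ t₁ t₂ ≤ U u₁ s₁ t₂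

/-- `s₂` is a (mixed) best response of player 2 to `t₁`. -/
def IsBR2 {α β : Type*} [Fintype α] [Fintype β]
    (u₂ : α → β → ℝ) (t₁ : α → ℝ) (s₂ : β → ℝ) : Prop :=
  IsMixed s₂ ∧ ∀ t₂, IsMixed t₂ → U u₂ t₁ t₂ ≤ U u₂ t₁ s₂

/-- `s₁` solves player 1's Definition-4 problem: player 1 is rational assuming
player 2 is both rational and correct. -/
def Solves1 {α β : Type*} [Fintype α] [Fintype β]
    (u₁ u₂ : α → β → ℝ) (s₁ : α → ℝ) : Prop :=
  IsMixed s₁ ∧ ∃ t₂, IsBR2 u₂ s₁ t₂ ∧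
    ∀ t₁ t₂', IsMixed t₁ → IsBR2 u₂ t₁ t₂' → U u₁ t₁ t₂' ≤ U u₁ s₁ t₂

/-- `s₂` solves player 2's Definition-4 problem: player 2 is rational assuming
player 1 is both rational and correct. -/
def Solves2 {α β : Type*} [Fintype α] [Fintype β]
    (u₁ u₂ : α → β → ℝ) (s₂ : β → ℝ) : Prop :=
  IsMixed s₂ ∧ ∃ t₁, IsBR1 u₁ t₁ s₂ ∧
    ∀ t₂ t₁', IsMixed t₂ → IsBR1 u₁ t₁' t₂ → U u₂ t₁' t₂ ≤ U u₂ t₁ s₂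

/-- `s₁` is a maximin strategy for player 1. -/
def IsMaximin1 {α β : Type*} [Fintype α] [Fintype β]
    (u₁ : α → β → ℝ) (s₁ : α → ℝ) : Prop :=
  IsMixed s₁ ∧ ∀ t₁, IsMixed t₁ →
    sInf {x | ∃ t₂, IsMixed t₂ ∧ U u₁ t₁ t₂ = x} ≤
      sInf {x | ∃ t₂, IsMixed t₂ ∧ U u₁ s₁ t₂ = x}

/-- `s₂` is a maximin strategy for player 2. -/
def IsMaximin2 {α β : Type*} [Fintype α] [Fintype β]
    (u₂ : α → β → ℝ) (s₂ : β → ℝ) : Prop :=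
  IsMixed s₂ ∧ ∀ t₂, IsMixed t₂ →
    sInf {x | ∃ t₁, IsMixed t₁ ∧ U u₂ t₁ t₂ = x} ≤
      sInf {x | ∃ t₁, IsMixed t₁ ∧ U u₂ t₁ s₂ = x}

/-- The pure (Dirac) strategy on action `a`. -/
noncomputable def pureStrat {α : Type*} [DecidableEq α] (a : α) : α → ℝ :=
  fun b => if b = a then 1 else 0

theorem isLinearMap_U_left {α β : Type*} [Fintype α] [Fintype β]
    (u : α → β → ℝ) (t₂ : β → ℝ) : IsLinearMap ℝ fun t₁ => U u t₁ t₂ where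
  map_add x y := by simp [U, add_mul, Finset.sum_add_distrib]
  map_smul c x := by simp [U, mul_assoc, Finset.mul_sum]

theorem isLinearMap_U_right {α β : Type*} [Fintype α] [Fintype β]
    (u : α → β → ℝ) (t₁ : α → ℝ) : IsLinearMap ℝ fun t₂ => U u t₁ t₂ where
  map_add x y := by simp [U, mul_add, add_mul, Finset.sum_add_distrib]
  map_smul c x := by simp [U, mul_assoc, mul_left_comm c, Finset.mul_sum]

theorem continuous_U_left {α β : Type*} [Fintype α] [Fintype β]
    (u : α → β → ℝ) (t₂ : β → ℝ) : Continuous fun t₁ => U u t₁ t₂ := by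
  unfold U
  fun_prop

theorem continuous_U_right {α β : Type*} [Fintype α] [Fintype β]
    (u : α → β → ℝ) (t₁ : α → ℝ) : Continuous fun t₂ => U u t₁ t₂ := by
  unfold U
  fun_prop

theorem U_eq_neg_of_zero_sum {α β : Type*} [Fintype α] [Fintype β]
    {u₁ u₂ : α → β → ℝ} (hzs : ∀ a b, u₂ a b = -u₁ a b) (t₁ : α → ℝ) (t₂ : β → ℝ) :
    U u₂ t₁ t₂ = -U u₁ t₁ t₂ := by
  simp [U, hzs]

/-- The von Neumann minimax theorem, in saddle point form. -/
theorem exists_isMixed_saddlePoint {α β : Type*} [Fintype α] [Fintype β]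
    [Nonempty α] [Nonempty β] (u : α → β → ℝ) :
    ∃ (s₁ : α → ℝ) (s₂ : β → ℝ), IsMixed s₁ ∧ IsMixed s₂ ∧
      ∀ t₁ t₂, IsMixed t₁ → IsMixed t₂ → U u t₁ s₂ ≤ U u s₁ t₂ := by
  classical
  obtain ⟨s₂, hs₂, s₁, hs₁, h⟩ := Sion.exists_isSaddlePointOn
    (X := stdSimplex ℝ β) (Y := stdSimplex ℝ α) (f := fun t₂ t₁ => U u t₁ t₂)
    ⟨_, single_mem_stdSimplex ℝ (Classical.arbitrary β)⟩
    (convex_stdSimplex ℝ β) (isCompact_stdSimplex ℝ β)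
    (fun t₁ _ => (continuous_U_right u t₁).continuousOn.lowerSemicontinuousOn)
    (fun t₁ _ => (((isLinearMap_U_right u t₁).mk' _).convexOn
      (convex_stdSimplex ℝ β)).quasiconvexOn)
    (convex_stdSimplex ℝ α)
    ⟨_, single_mem_stdSimplex ℝ (Classical.arbitrary α)⟩
    (isCompact_stdSimplex ℝ α)
    (fun t₂ _ => (continuous_U_left u t₂).continuousOn.upperSemicontinuousOn)
    (fun t₂ _ => (((isLinearMap_U_left u t₂).mk' _).concaveOn
      (convex_stdSimplex ℝ α)).quasiconcaveOn)
  exact ⟨s₁, s₂, hs₁, hs₂, fun t₁ t₂ ht₁ ht₂ => h t₂ ht₂ t₁ ht₁⟩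

/-- Theorem 1 (Consistency in zero-sum games): MARC holds in every finite two-player
zero-sum game: there is a pair of mixed strategies that are mutual best responses
(so each player, with conjecture equal to the opponent's actual strategy, is both
rational and correct) and each of which solves the corresponding player's
Definition-4 problem. -/
theorem marc_holds_zero_sum
    {α β : Type*} [Fintype α] [Fintype β] [Nonempty α] [Nonempty β]
    (u₁ u₂ : α → β → ℝ) (hzs : ∀ a b, u₂ a b = -u₁ a b) :
    ∃ (s₁ : α → ℝ) (s₂ : β → ℝ), IsMixed s₁ ∧ IsMixed s₂ ∧
      (IsBR1 u₁ s₁ s₂ ∧ IsBR2 u₂ s₁ s₂) ∧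
      (Solves1 u₁ u₂ s₁ ∧ Solves2 u₁ u₂ s₂) := by
  obtain ⟨s₁, s₂, hs₁, hs₂, h⟩ := exists_isMixed_saddlePoint u₁
  have hU := U_eq_neg_of_zero_sum hzs
  have hbr₁ : IsBR1 u₁ s₁ s₂ := ⟨hs₁, fun t₁ ht₁ => h t₁ s₂ ht₁ hs₂⟩
  have hbr₂ : IsBR2 u₂ s₁ s₂ := by
    refine ⟨hs₂, fun t₂ ht₂ => ?_⟩
    rw [hU, hU]
    exact neg_le_neg (h s₁ t₂ hs₁ ht₂)
  refine ⟨s₁, s₂, hs₁, hs₂, ⟨hbr₁, hbr₂⟩, ⟨hs₁, s₂, hbr₂, fun t₁ t₂ ht₁ ht₂ => ?_⟩,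
    ⟨hs₂, s₁, hbr₁, fun t₂ t₁ ht₂ ht₁ => ?_⟩⟩
  · have := ht₂.2 s₂ hs₂
    rw [hU, hU, neg_le_neg_iff] at this
    exact this.trans (hbr₁.2 t₁ ht₁)
  · refine le_trans ?_ (hbr₂.2 t₂ ht₂)
    rw [hU, hU]
    exact neg_le_neg (ht₁.2 s₁ hs₁)
end

section
/- Consider the 2×2 game with action sets A_1 = {x_1, y_1}, A_2 = {x_2, y_2} and payoffs u_1(x_1,x_2) = 1, u_1(x_1,y_2) = 3, u_1(y_1,x_2) = 2, u_1(y_1,y_2) = 4, u_2(x_1,x_2) = 1, u_2(x_1,y_2) = 2, u_2(y_1,x_2) = 4, u_2(y_1,y_2) = 3. Then: (a) the pure strategy y_1 does not solve player 1's Definition-4 problem (the unique best response of player 2 to the pure strategy x_1 is y_2, and U_1(x_1, y_2) = 3 > 2 = U_1(y_1, t_2) for every best response t_2 of player 2 to y_1); and (b) MARC fails in this game: there is no pair (s_1, s_2) such that s_1 is a best response to s_2, s_2 is a best response to s_1, and each s_i solves player i's Definition-4 problem. -/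
/-- Player 1's payoffs in the dominance-solvable game (`x₁ = 0`, `y₁ = 1`, `x₂ = 0`,
`y₂ = 1`). -/
noncomputable def dv₁ (a b : Fin 2) : ℝ :=
  if a = 0 then (if b = 0 then 1 else 3) else (if b = 0 then 2 else 4)

/-- Player 2's payoffs in the dominance-solvable game. -/
noncomputable def dv₂ (a b : Fin 2) : ℝ :=
  if a = 0 then (if b = 0 then 1 else 2) else (if b = 0 then 4 else 3)

/-- Expected payoffs of player 1 in the dominance-solvable game. -/
theorem U_dv₁ (s t : Fin 2 → ℝ) :
    U dv₁ s t = s 0 * t 0 + 3 * (s 0 * t 1) + 2 * (s 1 * t 0) + 4 * (s 1 * t 1) := by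
  simp [U, dv₁, Fin.sum_univ_two]
  ring

/-- Expected payoffs of player 2 in the dominance-solvable game. -/
theorem U_dv₂ (s t : Fin 2 → ℝ) :
    U dv₂ s t = s 0 * t 0 + 2 * (s 0 * t 1) + 4 * (s 1 * t 0) + 3 * (s 1 * t 1) := by
  simp [U, dv₂, Fin.sum_univ_two]
  ring

theorem isMixed_pureStrat {α : Type*} [Fintype α] [DecidableEq α] (a : α) :
    IsMixed (pureStrat a) := by
  refine ⟨fun b => ?_, by simp [pureStrat]⟩
  unfold pureStrat
  split_ifs <;> norm_num

theorem IsMixed.add_eq_one {t : Fin 2 → ℝ} (h : IsMixed t) : t 0 + t 1 = 1 := by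
  simpa [Fin.sum_univ_two] using h.2

theorem IsMixed.eq_pureStrat_one {t : Fin 2 → ℝ} (h : IsMixed t) (h0 : t 0 ≤ 0) :
    t = pureStrat 1 := by
  have hsum := h.add_eq_one
  have hnonneg := h.1 0
  ext i
  fin_cases i <;> simp [pureStrat] <;> linarith

/-- The action `x₁` is strictly dominated, so player 1's only best response is `y₁`. -/
theorem IsBR1.eq_pureStrat_one {s t : Fin 2 → ℝ} (h : IsBR1 dv₁ s t) (ht : IsMixed t) :
    s = pureStrat 1 := by
  refine h.1.eq_pureStrat_one ?_
  have hle := h.2 _ (isMixed_pureStrat 1)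
  have hs := h.1.add_eq_one
  have ht := ht.add_eq_one
  rw [U_dv₁, U_dv₁, eq_sub_of_add_eq' hs, eq_sub_of_add_eq' ht] at hle
  simp [pureStrat] at hle
  linarith

theorem isBR2_pureStrat_zero_iff {t : Fin 2 → ℝ} :
    IsBR2 dv₂ (pureStrat 0) t ↔ t = pureStrat 1 := by
  constructor
  · intro h
    refine h.1.eq_pureStrat_one ?_
    have hle := h.2 _ (isMixed_pureStrat 1)
    have hsum := h.1.add_eq_one
    simp [U_dv₂, pureStrat] at hle
    linarith
  · rintro rfl
    refine ⟨isMixed_pureStrat 1, fun r hr => ?_⟩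
    have hsum := hr.add_eq_one
    have hnonneg := hr.1 0
    simp [U_dv₂, pureStrat]
    linarith

theorem U_dv₁_pureStrat_zero_one : U dv₁ (pureStrat 0) (pureStrat 1) = 3 := by
  simp [U_dv₁, pureStrat]

theorem IsBR2.U_dv₁_pureStrat_one {t : Fin 2 → ℝ} (h : IsBR2 dv₂ (pureStrat 1) t) :
    U dv₁ (pureStrat 1) t = 2 := by
  have hle := h.2 _ (isMixed_pureStrat 0)
  have hsum := h.1.add_eq_one
  have hnonneg := h.1.1 1
  simp [U_dv₂, pureStrat] at hle
  simp [U_dv₁, pureStrat]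
  linarith

theorem not_solves1_pureStrat_one : ¬ Solves1 dv₁ dv₂ (pureStrat 1) := by
  rintro ⟨-, t, ht, hmax⟩
  have hle := hmax _ _ (isMixed_pureStrat 0) (isBR2_pureStrat_zero_iff.2 rfl)
  rw [U_dv₁_pureStrat_zero_one, ht.U_dv₁_pureStrat_one] at hle
  norm_num at hle

/-- In the dominance-solvable game: (a) the pure strategy `y₁` does not solve player
1's Definition-4 problem (indeed the unique best response of player 2 to `x₁` is `y₂`,
with `U₁(x₁, y₂) = 3`, while `U₁(y₁, t₂) = 2` for every best response `t₂` of player 2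
to `y₁`); and (b) MARC fails in this game. -/
theorem marc_fails_dominance_solvable :
    ((∀ t₂ : Fin 2 → ℝ, IsMixed t₂ → (IsBR2 dv₂ (pureStrat 0) t₂ ↔ t₂ = pureStrat 1)) ∧
      U dv₁ (pureStrat 0) (pureStrat 1) = 3 ∧
      (∀ t₂ : Fin 2 → ℝ, IsBR2 dv₂ (pureStrat 1) t₂ → U dv₁ (pureStrat 1) t₂ = 2) ∧
      ¬ Solves1 dv₁ dv₂ (pureStrat 1)) ∧
    ¬ ∃ (s₁ s₂ : Fin 2 → ℝ),
        (IsBR1 dv₁ s₁ s₂ ∧ IsBR2 dv₂ s₁ s₂) ∧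
        (Solves1 dv₁ dv₂ s₁ ∧ Solves2 dv₁ dv₂ s₂) := by
  refine ⟨⟨fun _ _ => isBR2_pureStrat_zero_iff, U_dv₁_pureStrat_zero_one,
    fun _ h => h.U_dv₁_pureStrat_one, not_solves1_pureStrat_one⟩, ?_⟩
  rintro ⟨s₁, s₂, ⟨h₁, h₂⟩, hsolves, -⟩
  rw [h₁.eq_pureStrat_one h₂.1] at hsolves
  exact not_solves1_pureStrat_one hsolves
end
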